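/- Let λ = (k₁^{n_{k₁}} ⋯ k_s^{n_{k_s}}) with s ≥ 1, distinct positive integers k₁,…,k_s and multiplicities n_{k₁} ≥ ⋯ ≥ n_{k_s} ≥ 1; let t be the largest index with n_{k_t} ≥ 2 (t = 0 if n_{k₁} = 1); let L = lcm(k₁,…,k_s), G = gcd(k₁,…,k_s), and ε ∈ {−1,1}. Then the limit lim_{x→∞} (1/x) Σ_{n ≤ x} ∏_{j=1}^{s} (−1)^{n_{k_j}} C(εμ(n/k_j), n_{k_j}) exists and equals (6/π²)·ε₂(λ)/(G ∏_{p | L/G}(p+1)). -/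

import Mathlib

open Finset Filter

/-- The generalized binomial coefficient `C(a, j) = a(a-1)⋯(a-j+1)/j!`. -/
noncomputable def genBinom (a : ℝ) (j : ℕ) : ℝ :=
  (∏ i ∈ Finset.range j, (a - i)) / (Nat.factorial j)

/-- `μ(n/d)` with the convention that it is `0` when `n/d` is not an integer. -/
def muIf (n d : ℕ) : ℤ :=
  if d ∣ n then ArithmeticFunction.moebius (n / d) else 0

open MeasureTheory Topology FourierTransform SchwartzMap in
theorem integral_mul_exp_mul_fourier_eq {f : ℝ → ℂ} (hfm : AEStronglyMeasurable f volume)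
    (hf1 : ∀ t, ‖f t‖ ≤ 1) (hf0 : ∀ t < 0, f t = 0) {g : ℂ → ℂ}
    (hfg : ∀ z : ℂ, 0 < z.re → ∫ t : ℝ, f t * Complex.exp (-z * t) = g z)
    (φ : 𝓢(ℝ, ℂ)) {σ : ℝ} (hσ : 0 < σ) (y : ℝ) :
    ∫ t : ℝ, f t * Complex.exp (-(σ : ℂ) * t) * 𝓕 φ (t - y) =
      ∫ u : ℝ, g (σ + 2 * Real.pi * u * Complex.I) * (Real.fourierChar (u * y) • φ u) := by
  have hint : Integrable (fun t : ℝ => f t * Complex.exp (-(σ : ℂ) * t)) := by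
    have h1 : Integrable (fun t : ℝ => (Set.Ioi (0 : ℝ)).indicator
        (fun t => Real.exp (-σ * t)) t) := by
      rw [integrable_indicator_iff measurableSet_Ioi]
      exact integrableOn_exp_mul_Ioi (by linarith) 0
    have h2 : Integrable (fun t : ℝ => (Set.Ioi (0 : ℝ)).indicator
        (fun t => Complex.exp (-(σ : ℂ) * t)) t) := by
      rw [integrable_indicator_iff measurableSet_Ioi] at h1 ⊢
      refine h1.congr' ?_ ?_
      · exact (by fun_prop :
          Continuous fun t : ℝ => Complex.exp (-(σ : ℂ) * t)).aestronglyMeasurable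
      · refine ae_of_all _ fun t => ?_
        simp [Complex.norm_exp]
    refine (h2.bdd_mul (c := 1) hfm (ae_of_all _ hf1)).congr ?_
    have : ∀ᵐ t : ℝ, t ≠ 0 := by simp [ae_iff, measure_singleton]
    filter_upwards [this] with t ht
    by_cases h : 0 < t
    · simp [Set.indicator, h]
    · simp [hf0 t (lt_of_le_of_ne (not_lt.1 h) ht)]
  have hφ : Integrable (fun u : ℝ => Real.fourierChar (u * y) • φ u) := by
    refine (φ.integrable (μ := volume)).congr' ?_ ?_
    · exact (Continuous.smul (by fun_prop) φ.continuous).aestronglyMeasurable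
    · exact ae_of_all _ fun t => by simp
  have key := VectorFourier.integral_fourierIntegral_smul_eq_flip (L := innerₗ ℝ)
      Real.continuous_fourierChar continuous_inner hint hφ
  have e1 : ∀ u, VectorFourier.fourierIntegral Real.fourierChar volume (innerₗ ℝ)
      (fun t : ℝ => f t * Complex.exp (-(σ : ℂ) * t)) u =
      g (σ + 2 * Real.pi * u * Complex.I) := by
    intro u
    rw [← hfg _ (by simpa using hσ)]
    refine integral_congr_ae (ae_of_all _ fun t => ?_)
    simp only [Circle.smul_def, Real.fourierChar_apply, smul_eq_mul, innerₗ_apply_apply,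
      RCLike.inner_apply, conj_trivial]
    rw [mul_left_comm, ← Complex.exp_add]
    congr 2
    push_cast
    ring
  have e2 : ∀ t, VectorFourier.fourierIntegral Real.fourierChar volume (innerₗ ℝ).flip
      (fun u : ℝ => Real.fourierChar (u * y) • φ u) t = 𝓕 φ (t - y) := by
    intro t
    rw [fourier_coe, Real.fourier_real_eq]
    refine integral_congr_ae (ae_of_all _ fun u => ?_)
    simp only [Circle.smul_def, Real.fourierChar_apply, smul_eq_mul, innerₗ_apply_apply,
      RCLike.inner_apply, conj_trivial, LinearMap.flip_apply]
    rw [← mul_assoc, ← Complex.exp_add]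
    congr 2
    push_cast
    ring
  simp_rw [e1, e2, smul_eq_mul] at key
  exact key.symm

open MeasureTheory Topology FourierTransform SchwartzMap in
/-- If the Laplace transform of a bounded function extends continuously to the imaginary axis,
then the convolutions with Fourier transforms of test functions vanish at infinity. -/
theorem tendsto_integral_mul_fourier_sub {f : ℝ → ℂ} (hfm : AEStronglyMeasurable f volume)
    (hf1 : ∀ t, ‖f t‖ ≤ 1) (hf0 : ∀ t < 0, f t = 0) {g : ℂ → ℂ}
    (hg : ContinuousOn g {z | 0 ≤ z.re})
    (hfg : ∀ z : ℂ, 0 < z.re → ∫ t : ℝ, f t * Complex.exp (-z * t) = g z)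
    (φ : 𝓢(ℝ, ℂ)) (hφ : HasCompactSupport φ) :
    Tendsto (fun y : ℝ => ∫ t : ℝ, f t * 𝓕 φ (t - y)) atTop (𝓝 0) := by
  have hgl : ∀ σ : ℝ, 0 ≤ σ → Continuous fun u : ℝ => g (σ + 2 * Real.pi * u * Complex.I) := by
    intro σ hσ
    refine hg.comp_continuous (by fun_prop) fun u => ?_
    simpa using hσ
  have key : ∀ y : ℝ, ∫ t : ℝ, f t * 𝓕 φ (t - y) =
      ∫ u : ℝ, g (2 * Real.pi * u * Complex.I) * (Real.fourierChar (u * y) • φ u) := by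
    intro y
    have hL : Tendsto (fun σ : ℝ => ∫ t : ℝ, f t * Complex.exp (-(σ : ℂ) * t) * 𝓕 φ (t - y))
        (𝓝[>] 0) (𝓝 (∫ t : ℝ, f t * 𝓕 φ (t - y))) := by
      refine tendsto_integral_filter_of_dominated_convergence (fun t => ‖𝓕 φ (t - y)‖) ?_ ?_ ?_ ?_
      · refine Eventually.of_forall fun σ => ?_
        refine (hfm.mul (Continuous.aestronglyMeasurable (by fun_prop))).mul ?_
        exact ((𝓕 φ).continuous.comp (by fun_prop)).aestronglyMeasurable
      · filter_upwards [self_mem_nhdsWithin] with σ (hσ : 0 < σ)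
        refine ae_of_all _ fun t => ?_
        rw [norm_mul]
        refine mul_le_of_le_one_left (norm_nonneg _) ?_
        rcases lt_or_ge t 0 with h | h
        · simp [hf0 t h]
        · rw [norm_mul]
          refine mul_le_one₀ (hf1 t) (norm_nonneg _) ?_
          simp [Complex.norm_exp]
          positivity
      · exact ((𝓕 φ).integrable.comp_sub_right y).norm
      · refine ae_of_all _ fun t => ?_
        have : Tendsto (fun σ : ℝ => f t * Complex.exp (-(σ : ℂ) * t) * 𝓕 φ (t - y)) (𝓝 0)
            (𝓝 (f t * Complex.exp (-((0 : ℝ) : ℂ) * t) * 𝓕 φ (t - y))) :=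
          Continuous.tendsto (by fun_prop) 0
        simpa using this.mono_left nhdsWithin_le_nhds
    have hR : Tendsto (fun σ : ℝ => ∫ u : ℝ, g (σ + 2 * Real.pi * u * Complex.I) *
        (Real.fourierChar (u * y) • φ u)) (𝓝[>] 0)
        (𝓝 (∫ u : ℝ, g (2 * Real.pi * u * Complex.I) * (Real.fourierChar (u * y) • φ u))) := by
      have hcomp : IsCompact (Set.Icc (0 : ℝ) 1 ×ˢ tsupport φ) := isCompact_Icc.prod hφ
      obtain ⟨C, hC⟩ := hcomp.exists_bound_of_continuousOn
        (f := fun p : ℝ × ℝ => g (p.1 + 2 * Real.pi * p.2 * Complex.I))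
        (hg.comp (by fun_prop) (fun p hp => by simpa using hp.1.1))
      refine tendsto_integral_filter_of_dominated_convergence (fun t => C * ‖φ t‖) ?_ ?_ ?_ ?_
      · filter_upwards [self_mem_nhdsWithin] with σ (hσ : 0 < σ)
        exact ((hgl σ hσ.le).mul (Continuous.smul (by fun_prop) φ.continuous)).aestronglyMeasurable
      · filter_upwards [self_mem_nhdsWithin, mem_nhdsWithin_of_mem_nhds
          (Iio_mem_nhds (zero_lt_one : (0 : ℝ) < 1))] with σ (hσ : 0 < σ) (hσ1 : σ < 1)
        refine ae_of_all _ fun u => ?_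
        rw [norm_mul, Circle.norm_smul]
        by_cases hu : u ∈ tsupport φ
        · exact mul_le_mul_of_nonneg_right (hC (σ, u) ⟨⟨hσ.le, hσ1.le⟩, hu⟩) (norm_nonneg _)
        · simp [image_eq_zero_of_notMem_tsupport hu]
      · exact φ.integrable.norm.const_mul C
      · refine ae_of_all _ fun u => ?_
        refine Tendsto.mul_const _ ?_
        have h0 : ContinuousWithinAt g {z | 0 ≤ z.re} (2 * Real.pi * u * Complex.I) :=
          hg _ (by simp)
        refine h0.tendsto.comp (tendsto_nhdsWithin_iff.2 ⟨?_, ?_⟩)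
        · have : Tendsto (fun σ : ℝ => (σ : ℂ) + 2 * Real.pi * u * Complex.I) (𝓝 0)
            (𝓝 (((0 : ℝ) : ℂ) + 2 * Real.pi * u * Complex.I)) :=
            Continuous.tendsto (by fun_prop) 0
          simpa using this.mono_left nhdsWithin_le_nhds
        · filter_upwards [self_mem_nhdsWithin] with σ (hσ : 0 < σ)
          simpa using hσ.le
    refine tendsto_nhds_unique hL (hR.congr' ?_)
    filter_upwards [self_mem_nhdsWithin] with σ (hσ : 0 < σ)
    exact (integral_mul_exp_mul_fourier_eq hfm hf1 hf0 hfg φ hσ y).symm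
  simp_rw [key]
  have hRL := (Real.zero_at_infty_fourier
    (fun u : ℝ => g (2 * Real.pi * u * Complex.I) * φ u)).comp
      (tendsto_neg_atTop_atBot.mono_right atBot_le_cocompact)
  refine hRL.congr fun y => ?_
  simp only [Function.comp_apply]
  rw [Real.fourier_real_eq]
  refine integral_congr_ae (ae_of_all _ fun u => ?_)
  simp only [mul_neg, neg_neg, Circle.smul_def, smul_eq_mul]
  ring

open MeasureTheory Topology FourierTransform SchwartzMap ContDiff in
/-- There is a test function whose Fourier transform has integral `1`. -/
theorem exists_schwartz_hasCompactSupport_integral_fourier_eq_one :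
    ∃ φ : 𝓢(ℝ, ℂ), HasCompactSupport φ ∧ ∫ t : ℝ, 𝓕 φ t = 1 := by
  let b : ContDiffBump (0 : ℝ) := default
  have hc : HasCompactSupport (fun u : ℝ => ((b u : ℝ) : ℂ)) :=
    b.hasCompactSupport.comp_left (g := fun x : ℝ => (x : ℂ)) (by simp)
  have hs : ContDiff ℝ ∞ (fun u : ℝ => ((b u : ℝ) : ℂ)) :=
    Complex.ofRealCLM.contDiff.comp b.contDiff
  refine ⟨hc.toSchwartzMap hs, hc, ?_⟩
  set φ : 𝓢(ℝ, ℂ) := hc.toSchwartzMap hs with hφ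
  have h := congrArg (fun ψ : 𝓢(ℝ, ℂ) => ψ 0)
    (FourierTransform.fourierInv_fourier_eq φ : 𝓕⁻ (𝓕 φ : 𝓢(ℝ, ℂ)) = φ)
  simp only [fourierInv_coe, Real.fourierInv_eq] at h
  simp only [inner_zero_right, AddChar.map_zero_eq_one, one_smul] at h
  rw [h, hφ]
  change ((b 0 : ℝ) : ℂ) = 1
  rw [b.one_of_mem_closedBall]
  · simp
  · simpa using b.rIn_pos.le

open MeasureTheory Topology FourierTransform SchwartzMap in
/-- A Tauberian theorem: a bounded slowly oscillating function whose Laplace transform extends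
continuously to the imaginary axis tends to zero. -/
theorem tendsto_zero_of_laplace_continuousOn {f : ℝ → ℂ} (hfm : Measurable f)
    (hf1 : ∀ t, ‖f t‖ ≤ 1) (hf0 : ∀ t < 0, f t = 0) {g : ℂ → ℂ}
    (hg : ContinuousOn g {z | 0 ≤ z.re})
    (hfg : ∀ z : ℂ, 0 < z.re → ∫ t : ℝ, f t * Complex.exp (-z * t) = g z)
    (hosc : ∀ ε > 0, ∃ δ > 0, ∃ Y, ∀ y ≥ Y, ∀ v, |v| ≤ δ → ‖f (y + v) - f y‖ ≤ ε) :
    Tendsto f atTop (𝓝 0) := by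
  obtain ⟨φ, hφc, hφ1⟩ := exists_schwartz_hasCompactSupport_integral_fourier_eq_one
  set K : ℝ → ℂ := fun t => 𝓕 φ t with hK
  have hKi : Integrable K := (𝓕 φ).integrable
  have hKc : Continuous K := (𝓕 φ).continuous
  set C := ∫ t, ‖K t‖ with hC
  have hC0 : 0 ≤ C := integral_nonneg fun t => norm_nonneg _
  rw [Metric.tendsto_atTop]
  intro η hη
  obtain ⟨ε, hε, hεη⟩ : ∃ ε > 0, ε * (C + 3) < η := by
    refine ⟨η / (2 * (C + 3)), by positivity, ?_⟩
    field_simp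
    linarith
  obtain ⟨δ, hδ, Y, hY⟩ := hosc ε hε
  have htail : Tendsto (fun T : ℝ => ∫ v in {v : ℝ | T < |v|}, ‖K v‖) atTop (𝓝 0) := by
    have hm : ∀ T : ℝ, MeasurableSet {v : ℝ | T < |v|} := fun T =>
      measurableSet_lt measurable_const (by fun_prop)
    have := tendsto_integral_filter_of_dominated_convergence (μ := volume) (l := atTop)
      (F := fun (T : ℝ) v => ({v : ℝ | T < |v|}).indicator (fun v => ‖K v‖) v)
      (f := fun _ => 0) (fun v => ‖K v‖)
      (Eventually.of_forall fun T => (hKc.norm.measurable.indicator (hm T)).aestronglyMeasurable)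
      (Eventually.of_forall fun T => ae_of_all _ fun v => by
        by_cases h : v ∈ {v : ℝ | T < |v|} <;> simp [Set.indicator, h])
      hKi.norm
      (ae_of_all _ fun v => by
        refine tendsto_const_nhds.congr' ?_
        filter_upwards [eventually_ge_atTop |v|] with T hT
        rw [Set.indicator_of_notMem]
        simpa using hT)
    simp only [integral_zero] at this
    exact this.congr fun T => integral_indicator (hm T)
  obtain ⟨T, hT0, hT⟩ := ((eventually_gt_atTop 0).and
    (htail.eventually (gt_mem_nhds hε))).exists
  set R := T / δ with hR
  have hR0 : 0 < R := by positivity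
  have hdil : Tendsto (fun y : ℝ => ∫ t : ℝ, f (t / R) * K (t - y)) atTop (𝓝 0) := by
    refine tendsto_integral_mul_fourier_sub (f := fun t => f (t / R)) (g := fun z => R * g (R * z))
      (hfm.comp (by fun_prop)).aestronglyMeasurable (fun t => hf1 _)
      (fun t ht => hf0 _ (div_neg_of_neg_of_pos ht hR0)) ?_ ?_ φ hφc
    · refine continuousOn_const.mul (hg.comp (by fun_prop) fun z hz => ?_)
      simp only [Set.mem_ofPred_eq, Complex.re_ofReal_mul] at hz ⊢
      positivity
    · intro z hz
      rw [← hfg (R * z) (by rw [Complex.re_ofReal_mul]; positivity)]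
      have := Measure.integral_comp_div (fun t : ℝ => f t * Complex.exp (-(R * z) * t)) R
      rw [abs_of_pos hR0] at this
      rw [← Complex.real_smul, ← this]
      refine integral_congr_ae (ae_of_all _ fun t => ?_)
      have : (R : ℂ) ≠ 0 := by exact_mod_cast hR0.ne'
      simp only
      congr 2
      push_cast
      field_simp
  obtain ⟨y₀, hy₀⟩ := (Metric.tendsto_atTop.1 hdil) ε hε
  refine ⟨max Y (y₀ / R), fun x hx => ?_⟩
  have hxY : Y ≤ x := (le_max_left _ _).trans hx
  have hxy : y₀ ≤ R * x := by
    have := (le_max_right _ _).trans hx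
    rwa [div_le_iff₀' hR0] at this
  have h1 := hy₀ _ hxy
  have h2 : ∫ t : ℝ, f (t / R) * K (t - R * x) = ∫ v : ℝ, f (x + v / R) * K v := by
    rw [← integral_add_right_eq_self _ (R * x)]
    refine integral_congr_ae (ae_of_all _ fun t => ?_)
    simp only [add_sub_cancel_right]
    congr 2
    field_simp
    ring
  have hint1 : Integrable (fun v : ℝ => f (x + v / R) * K v) :=
    hKi.bdd_mul (c := 1) (hfm.comp (by fun_prop)).aestronglyMeasurable (ae_of_all _ fun v => hf1 _)
  have h3 : (∫ v : ℝ, f (x + v / R) * K v) - f x = ∫ v : ℝ, (f (x + v / R) - f x) * K v := by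
    simp_rw [sub_mul]
    rw [integral_sub hint1 (hKi.const_mul _), integral_const_mul, hφ1, mul_one]
  have hm : MeasurableSet {v : ℝ | T < |v|} := measurableSet_lt measurable_const (by fun_prop)
  have h4 : ‖∫ v : ℝ, (f (x + v / R) - f x) * K v‖ ≤ ε * C + 2 * ε := by
    have hb : ∀ v : ℝ, ‖(f (x + v / R) - f x) * K v‖ ≤
        ε * ‖K v‖ + 2 * ({v : ℝ | T < |v|}).indicator (fun v => ‖K v‖) v := by
      intro v
      rw [norm_mul]
      by_cases h : T < |v|
      · rw [Set.indicator_of_mem (by exact h)]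
        have := (norm_sub_le (f (x + v / R)) (f x)).trans (add_le_add (hf1 _) (hf1 _))
        nlinarith [norm_nonneg (K v), mul_nonneg hε.le (norm_nonneg (K v))]
      · rw [Set.indicator_of_notMem (by exact h)]
        have := hY x hxY (v / R) (by
          rw [abs_div, abs_of_pos hR0, div_le_iff₀ hR0, hR, mul_div_cancel₀ _ hδ.ne']
          exact not_lt.1 h)
        nlinarith [norm_nonneg (K v)]
    refine (norm_integral_le_of_norm_le ?_ (ae_of_all _ hb)).trans ?_
    · exact (hKi.norm.const_mul _).add ((hKi.norm.indicator hm).const_mul _)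
    · rw [integral_add (hKi.norm.const_mul _) ((hKi.norm.indicator hm).const_mul _),
        integral_const_mul, integral_const_mul, integral_indicator hm]
      linarith
  rw [dist_zero_right] at h1 ⊢
  rw [h2] at h1
  rw [← h3] at h4
  have : ‖f x‖ ≤ ‖∫ v : ℝ, f (x + v / R) * K v‖ + ‖(∫ v : ℝ, f (x + v / R) * K v) - f x‖ := by
    simpa using norm_sub_le (∫ v : ℝ, f (x + v / R) * K v)
      ((∫ v : ℝ, f (x + v / R) * K v) - f x)
  nlinarith

/-- The summatory function of a sequence with values in the unit disc grows at most linearly. -/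
theorem norm_sum_Icc_sub_sum_Icc_le {a : ℕ → ℂ} (ha : ∀ n, ‖a n‖ ≤ 1) {M N : ℕ} (h : M ≤ N) :
    ‖(∑ k ∈ Icc 1 N, a k) - ∑ k ∈ Icc 1 M, a k‖ ≤ (N : ℝ) - M := by
  induction N, h using Nat.le_induction with
  | base => simp
  | succ N hN ih =>
    rw [Finset.sum_Icc_succ_top (by omega)]
    calc _ = ‖((∑ k ∈ Icc 1 N, a k) - ∑ k ∈ Icc 1 M, a k) + a (N + 1)‖ := by congr 1; ring
      _ ≤ (N - M) + 1 := (norm_add_le _ _).trans (add_le_add ih (ha _))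
      _ = _ := by push_cast; ring

theorem norm_sum_Icc_floor_sub_le {a : ℕ → ℂ} (ha : ∀ n, ‖a n‖ ≤ 1) {x y : ℝ} (hx : 0 ≤ x)
    (hy : 0 ≤ y) :
    ‖(∑ k ∈ Icc 1 ⌊y⌋₊, a k) - ∑ k ∈ Icc 1 ⌊x⌋₊, a k‖ ≤ |y - x| + 1 := by
  wlog h : x ≤ y generalizing x y
  · rw [norm_sub_rev, abs_sub_comm]
    exact this hy hx (le_of_not_ge h)
  refine (norm_sum_Icc_sub_sum_Icc_le ha (Nat.floor_mono h)).trans ?_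
  rw [abs_of_nonneg (by linarith)]
  linarith [Nat.floor_le hy, Nat.lt_floor_add_one x]

theorem norm_sum_Icc_floor_le {a : ℕ → ℂ} (ha : ∀ n, ‖a n‖ ≤ 1) {x : ℝ} (hx : 0 ≤ x) :
    ‖∑ k ∈ Icc 1 ⌊x⌋₊, a k‖ ≤ x := by
  have := norm_sum_Icc_sub_sum_Icc_le ha (Nat.zero_le ⌊x⌋₊)
  simp only [Nat.cast_zero, sub_zero] at this
  exact (by simpa using this : ‖∑ k ∈ Icc 1 ⌊x⌋₊, a k‖ ≤ ⌊x⌋₊).trans (Nat.floor_le hx)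

open MeasureTheory in
theorem integral_exp_neg_mul_sum_Icc_eq {a : ℕ → ℂ} (ha : ∀ n, ‖a n‖ ≤ 1) {z : ℂ}
    (hz : 0 < z.re) :
    ∫ t : ℝ, ((Real.exp (-t) : ℂ) * ∑ k ∈ Icc 1 ⌊Real.exp t⌋₊, a k) * Complex.exp (-z * t) =
      LSeries a (z + 1) / (z + 1) := by
  have hz1 : z + 1 ≠ 0 := fun h => by
    have := congrArg Complex.re h
    simp at this
    linarith
  have hS : LSeries a (z + 1) = (z + 1) *
      ∫ t in Set.Ioi (1 : ℝ), (∑ k ∈ Icc 1 ⌊t⌋₊, a k) * (t : ℂ) ^ (-((z + 1) + 1)) := by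
    refine LSeries_eq_mul_integral' a zero_le_one (by simpa using hz) ?_
    refine Asymptotics.IsBigO.of_bound 1 (Eventually.of_forall fun n => ?_)
    rw [Real.norm_of_nonneg (by positivity), Real.rpow_one, Real.norm_of_nonneg (by positivity),
      one_mul]
    calc ∑ k ∈ Icc 1 n, ‖a k‖ ≤ ∑ k ∈ Icc 1 n, (1 : ℝ) := sum_le_sum fun k _ => ha k
      _ = n := by simp
  rw [hS, mul_div_cancel_left₀ _ hz1]
  have himg : Real.exp '' Set.Ioi 0 = Set.Ioi 1 := by
    ext x
    constructor
    · rintro ⟨t, ht, rfl⟩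
      simpa using ht
    · intro hx
      have hx : (1 : ℝ) < x := hx
      exact ⟨Real.log x, Real.log_pos hx, Real.exp_log (by linarith)⟩
  rw [← himg, integral_image_eq_integral_abs_deriv_smul measurableSet_Ioi
    (fun x _ => (Real.hasDerivAt_exp x).hasDerivWithinAt) Real.exp_injective.injOn,
    ← setIntegral_eq_integral_of_forall_compl_eq_zero (s := Set.Ici 0),
    integral_Ici_eq_integral_Ioi]
  · refine setIntegral_congr_fun measurableSet_Ioi fun t _ => ?_
    have h1 : ((Real.exp t : ℝ) : ℂ) ^ (-((z + 1) + 1)) = Complex.exp (-(z + 1 + 1) * t) := by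
      rw [Complex.cpow_def_of_ne_zero (by exact_mod_cast (Real.exp_pos t).ne'),
        ← Complex.ofReal_log (Real.exp_pos t).le, Real.log_exp]
      congr 1
      ring
    simp only [h1, abs_of_pos (Real.exp_pos t), Complex.real_smul]
    push_cast
    rw [mul_right_comm, ← Complex.exp_add, mul_comm (∑ k ∈ _, a k), ← mul_assoc,
      ← Complex.exp_add]
    congr 2
    ring
  · intro t ht
    have : ⌊Real.exp t⌋₊ = 0 := by
      rw [Nat.floor_eq_zero]
      simpa using ht
    simp [this]

open Topology in
/-- A bounded sequence whose L-series extends continuously to the line `re s = 1` has mean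
value zero. -/
theorem tendsto_sum_div_of_LSeries_continuousOn {a : ℕ → ℂ} (ha : ∀ n, ‖a n‖ ≤ 1) {H : ℂ → ℂ}
    (hH : ContinuousOn H {s | 1 ≤ s.re}) (hHa : ∀ s : ℂ, 1 < s.re → LSeries a s = H s) :
    Tendsto (fun N : ℕ => (∑ n ∈ Icc 1 N, a n) / N) atTop (𝓝 0) := by
  have hmain : Tendsto (fun t : ℝ => (Real.exp (-t) : ℂ) * ∑ k ∈ Icc 1 ⌊Real.exp t⌋₊, a k)
      atTop (𝓝 0) := by
    refine tendsto_zero_of_laplace_continuousOn (g := fun z => H (z + 1) / (z + 1))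
      ?_ ?_ ?_ ?_ ?_ ?_
    · refine Measurable.mul (by fun_prop) ?_
      exact (measurable_from_nat (f := fun n => ∑ k ∈ Icc 1 n, a k)).comp
        (Nat.measurable_floor.comp Real.measurable_exp)
    · intro t
      rw [norm_mul, Complex.norm_real, Real.norm_of_nonneg (Real.exp_pos _).le]
      calc _ ≤ Real.exp (-t) * Real.exp t := by
            gcongr
            exact norm_sum_Icc_floor_le ha (Real.exp_pos t).le
        _ = 1 := by rw [← Real.exp_add]; simp
    · intro t ht
      have : ⌊Real.exp t⌋₊ = 0 := by
        rw [Nat.floor_eq_zero]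
        simpa using ht
      simp [this]
    · refine (hH.comp (by fun_prop) fun z hz => ?_).div (by fun_prop) fun z hz h => ?_
      · have hz : 0 ≤ z.re := hz
        simpa using hz
      · have hz : 0 ≤ z.re := hz
        have := congrArg Complex.re h
        simp at this
        linarith
    · intro z hz
      rw [integral_exp_neg_mul_sum_Icc_eq ha hz, hHa _ (by simpa using hz)]
    · intro ε hε
      have hc : Tendsto (fun v : ℝ => 2 * |1 - Real.exp (-v)|) (𝓝 0) (𝓝 0) := by
        have : Continuous fun v : ℝ => 2 * |1 - Real.exp (-v)| := by fun_prop
        simpa using this.tendsto 0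
      obtain ⟨δ, hδ, hδ'⟩ := Metric.eventually_nhds_iff.1
        (hc.eventually (gt_mem_nhds (half_pos hε)))
      have hY : Tendsto (fun y : ℝ => Real.exp (1 - y)) atTop (𝓝 0) :=
        Real.tendsto_exp_atBot.comp (tendsto_atBot_add_const_left _ 1 tendsto_neg_atTop_atBot)
      obtain ⟨Y, hY⟩ := eventually_atTop.1 (hY.eventually (gt_mem_nhds (half_pos hε)))
      refine ⟨min (δ / 2) 1, by positivity, Y, fun y hy v hv => ?_⟩
      have hv1 : |v| ≤ 1 := hv.trans (min_le_right _ _)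
      have hvδ : dist v 0 < δ := by
        rw [dist_zero_right, Real.norm_eq_abs]
        linarith [hv.trans (min_le_left _ _)]
      have h1 := hδ' hvδ
      have h2 := hY y hy
      set X := Real.exp y
      set X' := Real.exp (y + v)
      set A := ∑ k ∈ Icc 1 ⌊X⌋₊, a k
      set A' := ∑ k ∈ Icc 1 ⌊X'⌋₊, a k
      have hA : ‖A‖ ≤ X := norm_sum_Icc_floor_le ha (Real.exp_pos y).le
      have hA' : ‖A' - A‖ ≤ |X' - X| + 1 :=
        norm_sum_Icc_floor_sub_le ha (Real.exp_pos _).le (Real.exp_pos _).le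
      have e1 : Real.exp (-(y + v)) * |X' - X| = |1 - Real.exp (-v)| := by
        rw [← abs_of_pos (Real.exp_pos (-(y + v))), ← abs_mul, mul_sub, ← Real.exp_add,
          ← Real.exp_add]
        ring_nf
        simp
      have e2 : |Real.exp (-(y + v)) - Real.exp (-y)| * X = |1 - Real.exp (-v)| := by
        have hX : |X| = X := abs_of_pos (Real.exp_pos y)
        rw [← hX, ← abs_mul, sub_mul, ← Real.exp_add, ← Real.exp_add, abs_sub_comm]
        ring_nf
        simp
      have e3 : Real.exp (-(y + v)) ≤ Real.exp (1 - y) := by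
        apply Real.exp_le_exp.2
        linarith [neg_abs_le v]
      calc ‖(Real.exp (-(y + v)) : ℂ) * A' - (Real.exp (-y) : ℂ) * A‖
          = ‖(Real.exp (-(y + v)) : ℂ) * (A' - A) +
              ((Real.exp (-(y + v)) - Real.exp (-y) : ℝ) : ℂ) * A‖ := by
            congr 1; push_cast; ring
        _ ≤ Real.exp (-(y + v)) * ‖A' - A‖ + |Real.exp (-(y + v)) - Real.exp (-y)| * ‖A‖ := by
            refine (norm_add_le _ _).trans ?_
            rw [norm_mul, norm_mul, Complex.norm_real, Complex.norm_real, Real.norm_eq_abs,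
              Real.norm_eq_abs, abs_of_pos (Real.exp_pos _)]
        _ ≤ Real.exp (-(y + v)) * (|X' - X| + 1) +
              |Real.exp (-(y + v)) - Real.exp (-y)| * X := by
            gcongr
        _ ≤ ε := by
            rw [mul_add, e1, e2]
            linarith
  have hN : Tendsto (fun N : ℕ => Real.log N) atTop atTop :=
    Real.tendsto_log_atTop.comp tendsto_natCast_atTop_atTop
  refine (hmain.comp hN).congr' ?_
  filter_upwards [eventually_gt_atTop 0] with N hN
  have hN' : (0 : ℝ) < N := by exact_mod_cast hN
  simp only [Function.comp_apply]
  rw [Real.exp_log hN', Nat.floor_natCast, Real.exp_neg, Real.exp_log hN']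
  push_cast
  rw [inv_mul_eq_div]

open ArithmeticFunction in
theorem LSeries_coprime_moebius_eq {D : ℕ} [NeZero D] {s : ℂ} (hs : 1 < s.re) :
    LSeries (fun n => if D.Coprime n then (moebius n : ℂ) else 0) s =
      (DirichletCharacter.LFunctionTrivChar D s)⁻¹ := by
  have h := DirichletCharacter.LSeries.mul_mu_eq_one (1 : DirichletCharacter ℂ D) hs
  rw [← DirichletCharacter.LFunction_eq_LSeries _ hs] at h
  rw [← eq_inv_of_mul_eq_one_right h]
  congr 1
  ext n
  by_cases hn : D.Coprime n
  · simp [hn, MulChar.one_apply ((ZMod.isUnit_iff_coprime n D).2 hn.symm)]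
  · have : ¬ IsUnit (n : ZMod D) := fun h => hn ((ZMod.isUnit_iff_coprime n D).1 h).symm
    simp [hn, MulChar.map_nonunit _ this]

open ArithmeticFunction in
theorem tendsto_sum_coprime_moebius_div {D : ℕ} (hD : D ≠ 0) :
    Tendsto (fun N : ℕ => (∑ n ∈ Icc 1 N, if D.Coprime n then (moebius n : ℝ) else 0) / N)
      atTop (nhds 0) := by
  have : NeZero D := ⟨hD⟩
  have key := tendsto_sum_div_of_LSeries_continuousOn
    (a := fun n => if D.Coprime n then (moebius n : ℂ) else 0)
    (H := fun s => (s - 1) / DirichletCharacter.LFunctionTrivChar₁ D s) ?_ ?_ ?_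
  · rw [← tendsto_ofReal_iff]
    refine (by simpa using key : Tendsto _ _ (nhds (((0 : ℝ)) : ℂ))).congr fun N => ?_
    push_cast [apply_ite]
    simp
  · intro n
    split_ifs
    · rw [Complex.norm_intCast]
      exact_mod_cast abs_moebius_le_one
    · simp
  · refine ContinuousOn.div (by fun_prop)
      (DirichletCharacter.differentiable_LFunctionTrivChar₁ D).continuous.continuousOn ?_
    intro s hs
    rcases eq_or_ne s 1 with rfl | h
    · exact DirichletCharacter.LFunctionTrivChar₁_apply_one_ne_zero D
    · rw [DirichletCharacter.LFunctionTrivChar₁,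
      Function.update_of_ne h]
      exact mul_ne_zero (sub_ne_zero.2 h)
        (DirichletCharacter.LFunction_ne_zero_of_one_le_re _ (.inr h) hs)
  · intro s hs
    have h : s ≠ 1 := by rintro rfl; simp at hs
    rw [LSeries_coprime_moebius_eq hs, DirichletCharacter.LFunctionTrivChar₁,
      Function.update_of_ne h]
    have := sub_ne_zero.2 h
    rw [div_mul_eq_div_div, div_self this, one_div]

/-- The number of integers up to `N` that are coprime to `D`. -/
def coprimeCount (D N : ℕ) : ℕ := #{n ∈ Icc 1 N | D.Coprime n}

theorem coprimeCount_le (D N : ℕ) : coprimeCount D N ≤ N := by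
  simpa [coprimeCount] using card_filter_le (Icc 1 N) D.Coprime

theorem coprimeCount_mono (D : ℕ) : Monotone (coprimeCount D) := fun _ _ h =>
  card_le_card (filter_subset_filter _ (Icc_subset_Icc_right h))

theorem coprimeCount_mul (D q : ℕ) : coprimeCount D (D * q) = D.totient * q := by
  induction q with
  | zero => simp [coprimeCount]
  | succ q ih =>
    have h1 : Icc 1 (D * (q + 1)) =
        Icc 1 (D * q) ∪ Ico (D * q + 1) (D * q + 1 + D) := by
      ext x
      simp only [mem_Icc, mem_union, mem_Ico, mul_add, mul_one]
      omega
    have h2 : Disjoint (Icc 1 (D * q)) (Ico (D * q + 1) (D * q + 1 + D)) := by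
      rw [disjoint_left]
      intro x
      simp only [mem_Icc, mem_Ico]
      omega
    rw [coprimeCount, h1, filter_union, card_union_of_disjoint (disjoint_filter_filter h2),
      Nat.filter_coprime_Ico_eq_totient, ← coprimeCount, ih, mul_add, mul_one]

theorem tendsto_natCast_div_div {d : ℕ} :
    Tendsto (fun N : ℕ => ((N / d : ℕ) : ℝ) / N) atTop (nhds (1 / d)) := by
  refine ((tendsto_nat_floor_mul_div_atTop (a := (1 : ℝ) / d) (by positivity)).comp
    tendsto_natCast_atTop_atTop).congr fun N => ?_
  simp only [Function.comp_apply]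
  rw [one_div_mul_eq_div, Nat.floor_div_natCast, Nat.floor_natCast]

theorem tendsto_coprimeCount_div {D : ℕ} (hD : D ≠ 0) :
    Tendsto (fun N : ℕ => (coprimeCount D N : ℝ) / N) atTop (nhds (D.totient / D)) := by
  have hfl := tendsto_natCast_div_div (d := D)
  have hlo : Tendsto (fun N : ℕ => (D.totient : ℝ) * (((N / D : ℕ) : ℝ) / N)) atTop
      (nhds (D.totient / D)) := by
    simpa [div_eq_mul_inv] using hfl.const_mul (D.totient : ℝ)
  have hhi : Tendsto (fun N : ℕ => (D.totient : ℝ) * (((N / D : ℕ) : ℝ) / N) + D.totient / N)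
      atTop (nhds (D.totient / D)) := by
    simpa using hlo.add (tendsto_const_div_atTop_nhds_zero_nat (D.totient : ℝ))
  refine tendsto_of_tendsto_of_tendsto_of_le_of_le hlo hhi (fun N => ?_) fun N => ?_
  · have := coprimeCount_mono D (Nat.mul_div_le N D)
    rw [coprimeCount_mul] at this
    simp only
    rw [← mul_div_assoc]
    gcongr
    exact_mod_cast this
  · have := coprimeCount_mono D (Nat.lt_mul_div_succ N (Nat.pos_of_ne_zero hD)).le
    rw [coprimeCount_mul] at this
    simp only
    rw [← mul_div_assoc, ← add_div]
    gcongr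
    exact_mod_cast this

theorem Nat.sq_dvd_sq_mul_squarefree_iff {a b d : ℕ} (ha : a ≠ 0) (hb : Squarefree b) :
    d ^ 2 ∣ a ^ 2 * b ↔ d ∣ a := by
  refine ⟨fun h => ?_, fun h => (pow_dvd_pow_of_dvd h 2).mul_right b⟩
  have hb0 := hb.ne_zero
  have hd0 : d ≠ 0 := by
    rintro rfl
    rw [zero_pow two_ne_zero, zero_dvd_iff] at h
    simp_all
  rw [← Nat.factorization_le_iff_dvd (by positivity) (by positivity)] at h
  rw [← Nat.factorization_le_iff_dvd hd0 ha]
  intro p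
  have h1 := h p
  have h2 := hb.natFactorization_le_one p
  rw [Nat.factorization_mul (by positivity) hb0] at h1
  simp only [Nat.factorization_pow, Finsupp.add_apply, Finsupp.smul_apply, smul_eq_mul] at h1
  omega

open ArithmeticFunction in
theorem moebius_sq_eq_sum_sq_dvd {n N : ℕ} (hn : n ≠ 0) (hN : n ≤ N) :
    (moebius n) ^ 2 = ∑ d ∈ Icc 1 N with d ^ 2 ∣ n, moebius d := by
  obtain ⟨b, a, hab, hb⟩ := Nat.sq_mul_squarefree n
  have ha : a ≠ 0 := by
    rintro rfl
    simp at hab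
    exact hn hab.symm
  have h1 : (Icc 1 N).filter (fun d => d ^ 2 ∣ n) = a.divisors := by
    ext d
    rw [mem_filter, ← hab, Nat.sq_dvd_sq_mul_squarefree_iff ha hb, Nat.mem_divisors, mem_Icc]
    refine ⟨fun h => ⟨h.2, ha⟩, fun h => ⟨⟨Nat.pos_of_dvd_of_pos h.1 (by omega), ?_⟩, h.1⟩⟩
    refine (Nat.le_of_dvd (by omega) ?_).trans hN
    rw [← hab]
    exact h.1.trans ((dvd_pow_self a two_ne_zero).mul_right b)
  rw [h1, ← coe_mul_zeta_apply, moebius_mul_coe_zeta, one_apply, moebius_sq]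
  refine if_congr ⟨fun h => ?_, fun h => ?_⟩ rfl rfl
  · rw [← hab] at h
    exact Nat.isUnit_iff.1 (h a ⟨b, by ring⟩)
  · rw [← hab, h]
    simpa using hb

theorem card_coprime_sq_dvd {D d N : ℕ} (hd : d ≠ 0) :
    #{n ∈ Icc 1 N | D.Coprime n ∧ d ^ 2 ∣ n} =
      if D.Coprime d then coprimeCount D (N / d ^ 2) else 0 := by
  have hd2 : 0 < d ^ 2 := by positivity
  split_ifs with h
  · rw [coprimeCount, ← card_image_of_injective ((Icc 1 (N / d ^ 2)).filter D.Coprime)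
      (mul_right_injective₀ hd2.ne')]
    congr 1
    ext n
    simp only [mem_filter, mem_Icc, mem_image]
    constructor
    · rintro ⟨⟨h1, h2⟩, h3, r, rfl⟩
      refine ⟨r, ⟨⟨Nat.pos_of_ne_zero ?_, ?_⟩, h3.coprime_mul_left_right⟩, rfl⟩
      · rintro rfl
        simp at h1
      · rw [Nat.le_div_iff_mul_le hd2]
        linarith
    · rintro ⟨r, ⟨⟨h1, h2⟩, h3⟩, rfl⟩
      rw [Nat.le_div_iff_mul_le hd2] at h2
      exact ⟨⟨Nat.mul_pos hd2 h1, by linarith⟩, (h.pow_right 2).mul_right h3, dvd_mul_right _ _⟩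
  · rw [card_eq_zero, filter_eq_empty_iff]
    rintro n - ⟨h1, h2⟩
    exact h (h1.coprime_dvd_right ((dvd_pow_self d two_ne_zero).trans h2))

open ArithmeticFunction in
theorem sum_coprime_moebius_sq_eq (D N : ℕ) :
    ∑ n ∈ Icc 1 N, (if D.Coprime n then (moebius n : ℝ) ^ 2 else 0) =
      ∑' d : ℕ, (if D.Coprime d then (moebius d : ℝ) else 0) * coprimeCount D (N / d ^ 2) := by
  rw [tsum_eq_sum (s := Icc 1 N)]
  · have h1 : ∀ n ∈ Icc 1 N, (if D.Coprime n then (moebius n : ℝ) ^ 2 else 0) =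
        ∑ d ∈ Icc 1 N, if D.Coprime n ∧ d ^ 2 ∣ n then (moebius d : ℝ) else 0 := by
      intro n hn
      rw [mem_Icc] at hn
      by_cases h : D.Coprime n
      · have := congrArg (fun x : ℤ => (x : ℝ))
          (moebius_sq_eq_sum_sq_dvd (n := n) (N := N) (by omega) hn.2)
        push_cast at this
        rw [if_pos h, this, sum_filter]
        exact sum_congr rfl fun d _ => if_congr ⟨fun hd => ⟨h, hd⟩, fun hd => hd.2⟩ rfl rfl
      · simp [h]
    rw [sum_congr rfl h1, sum_comm]
    refine sum_congr rfl fun d hd => ?_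
    rw [mem_Icc] at hd
    rw [← sum_filter, sum_const, card_coprime_sq_dvd (by omega), nsmul_eq_mul]
    split_ifs <;> simp [mul_comm]
  · intro d hd
    have : N / d ^ 2 = 0 := by
      rw [mem_Icc] at hd
      rcases Nat.eq_zero_or_pos d with rfl | h
      · simp
      · rw [Nat.div_eq_zero_iff]
        right
        have : N < d := by omega
        nlinarith
    simp [this, coprimeCount]

open ArithmeticFunction in
theorem tsum_coprime_moebius_div_sq {D : ℕ} (hD : D ≠ 0) :
    ∑' d : ℕ, (if D.Coprime d then (moebius d : ℝ) else 0) * (D.totient / D / d ^ 2) =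
      6 / Real.pi ^ 2 * ∏ p ∈ D.primeFactors, ((p : ℝ) / (p + 1)) := by
  have : NeZero D := ⟨hD⟩
  have h2 := LSeries_coprime_moebius_eq (D := D) (s := 2) (by norm_num)
  rw [DirichletCharacter.LFunctionTrivChar_eq_mul_riemannZeta (by norm_num), riemannZeta_two] at h2
  have h3 : LSeries (fun n => if D.Coprime n then (moebius n : ℂ) else 0) 2 =
      ((∑' d : ℕ, (if D.Coprime d then (moebius d : ℝ) else 0) / (d : ℝ) ^ 2 : ℝ) : ℂ) := by
    rw [LSeries, Complex.ofReal_tsum]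
    refine tsum_congr fun d => ?_
    rcases eq_or_ne d 0 with rfl | hd
    · simp
    · rw [LSeries.term_of_ne_zero hd]
      push_cast [apply_ite]
      norm_cast
  have h4 : ∑' d : ℕ, (if D.Coprime d then (moebius d : ℝ) else 0) / (d : ℝ) ^ 2 =
      ((∏ p ∈ D.primeFactors, (1 - ((p : ℝ) ^ 2)⁻¹)) * (Real.pi ^ 2 / 6))⁻¹ := by
    rw [h3] at h2
    apply Complex.ofReal_injective
    rw [h2]
    push_cast
    congr 2
    refine prod_congr rfl fun p _ => ?_
    rw [Complex.cpow_neg]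
    norm_cast
  have h5 : (D.totient : ℝ) / D = ∏ p ∈ D.primeFactors, (1 - (p : ℝ)⁻¹) := by
    have := congrArg (fun x : ℚ => (x : ℝ)) (Nat.totient_eq_mul_prod_factors D)
    push_cast at this
    rw [this, mul_div_cancel_left₀ _ (by exact_mod_cast hD)]
  calc _ = (D.totient : ℝ) / D *
        ∑' d : ℕ, (if D.Coprime d then (moebius d : ℝ) else 0) / (d : ℝ) ^ 2 := by
        rw [← tsum_mul_left]
        refine tsum_congr fun d => ?_
        ring
    _ = _ := by
        rw [h4, h5, mul_inv, mul_comm _ (Real.pi ^ 2 / 6)⁻¹, mul_left_comm, inv_div,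
          ← prod_inv_distrib, ← prod_mul_distrib]
        congr 1
        refine prod_congr rfl fun p hp => ?_
        have hp1 : (1 : ℝ) < p := by exact_mod_cast (Nat.prime_of_mem_primeFactors hp).one_lt
        have e1 : (p : ℝ) - 1 ≠ 0 := by linarith
        have e2 : (p : ℝ) + 1 ≠ 0 := by linarith
        have e3 : (p : ℝ) ≠ 0 := by linarith
        have e4 : (1 : ℝ) - ((p : ℝ) ^ 2)⁻¹ = (p - 1) * (p + 1) / p ^ 2 := by
          field_simp
          ring
        rw [e4]
        field_simp

open ArithmeticFunction in
/-- The density of the squarefree integers that are coprime to `D`. -/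
theorem tendsto_sum_coprime_moebius_sq_div {D : ℕ} (hD : D ≠ 0) :
    Tendsto (fun N : ℕ =>
      (∑ n ∈ Icc 1 N, if D.Coprime n then (moebius n : ℝ) ^ 2 else 0) / N) atTop
      (nhds (6 / Real.pi ^ 2 * ∏ p ∈ D.primeFactors, ((p : ℝ) / (p + 1)))) := by
  rw [← tsum_coprime_moebius_div_sq hD]
  have hsum : Summable fun d : ℕ => 1 / (d : ℝ) ^ 2 :=
    Real.summable_one_div_nat_pow.2 one_lt_two
  refine (tendsto_tsum_of_dominated_convergence (𝓕 := atTop)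
    (f := fun (N : ℕ) (d : ℕ) => (if D.Coprime d then (moebius d : ℝ) else 0) *
      (coprimeCount D (N / d ^ 2) / N)) hsum (fun d => ?_)
    (Eventually.of_forall fun N d => ?_)).congr fun N => ?_
  · refine Tendsto.const_mul _ ?_
    rcases eq_or_ne d 0 with rfl | hd
    · simp [coprimeCount]
    have hd2 : 0 < d ^ 2 := by positivity
    have hdiv : Tendsto (fun N : ℕ => N / d ^ 2) atTop atTop :=
      Nat.tendsto_div_const_atTop hd2.ne'
    have hfl := tendsto_natCast_div_div (d := d ^ 2)
    have := ((tendsto_coprimeCount_div hD).comp hdiv).mul hfl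
    refine (this.congr' ?_).trans (le_of_eq ?_)
    · filter_upwards [eventually_ge_atTop (d ^ 2)] with N hN
      have : ((N / d ^ 2 : ℕ) : ℝ) ≠ 0 := by
        exact_mod_cast (Nat.div_pos hN hd2).ne'
      simp only [Function.comp_apply]
      field_simp
    · push_cast
      rw [mul_one_div]
  · rw [Real.norm_eq_abs, abs_mul, ← one_mul (1 / (d : ℝ) ^ 2)]
    refine mul_le_mul ?_ ?_ (abs_nonneg _) zero_le_one
    · split_ifs
      · exact_mod_cast abs_moebius_le_one
      · simp
    · rw [abs_of_nonneg (by positivity)]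
      rcases Nat.eq_zero_or_pos N with rfl | hN
      · simp
      have hN' : (0 : ℝ) < N := by exact_mod_cast hN
      rw [div_le_iff₀ hN', one_div_mul_eq_div]
      calc (coprimeCount D (N / d ^ 2) : ℝ) ≤ (N / d ^ 2 : ℕ) := by
            exact_mod_cast coprimeCount_le _ _
        _ ≤ _ := by exact_mod_cast Nat.cast_div_le (α := ℝ) (m := N) (n := d ^ 2)
  · rw [sum_coprime_moebius_sq_eq, ← tsum_div_const]
    exact tsum_congr fun d => (mul_div_assoc _ _ _).symm

theorem genBinom_neg_one (m : ℕ) : genBinom (-1) m = (-1) ^ m := by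
  have h : ∏ i ∈ range m, ((-1 : ℝ) - i) = (-1) ^ m * m.factorial := by
    induction m with
    | zero => simp
    | succ m ih =>
      rw [prod_range_succ, ih, Nat.factorial_succ]
      push_cast
      ring
  rw [genBinom, h, mul_div_cancel_right₀ _ (by positivity)]

theorem genBinom_natCast_of_lt {a m : ℕ} (h : a < m) : genBinom a m = 0 := by
  rw [genBinom, prod_eq_zero (mem_range.2 h) (sub_self _), zero_div]

theorem neg_one_pow_mul_genBinom {a : ℤ} (ha : a = 0 ∨ a = 1 ∨ a = -1) {m : ℕ} (hm : 1 ≤ m) :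
    (-1 : ℝ) ^ m * genBinom a m = if 2 ≤ m then ((a : ℝ) ^ 2 - a) / 2 else -(a : ℝ) := by
  have h0 : genBinom 0 m = 0 := by simpa using genBinom_natCast_of_lt (a := 0) (m := m) hm
  have h1 : (-1 : ℝ) ^ m * genBinom (-1) m = 1 := by
    rw [genBinom_neg_one, ← mul_pow]
    norm_num
  split_ifs with h
  · have h2 : genBinom 1 m = 0 := by simpa using genBinom_natCast_of_lt (a := 1) (m := m) h
    rcases ha with rfl | rfl | rfl
    · simp [h0]
    · simp [h2]
    · push_cast
      rw [h1]
      norm_num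
  · obtain rfl : m = 1 := by omega
    simp [genBinom]

theorem sum_Icc_eq_sum_Icc_div {M : Type*} [AddCommMonoid M] {d : ℕ} (hd : 0 < d) {f : ℕ → M}
    (hf : ∀ n, ¬ d ∣ n → f n = 0) (N : ℕ) :
    ∑ n ∈ Icc 1 N, f n = ∑ q ∈ Icc 1 (N / d), f (d * q) := by
  rw [← sum_image (s := Icc 1 (N / d)) (g := fun q => d * q) (f := f)
    (fun a _ b _ h => Nat.eq_of_mul_eq_mul_left hd h)]
  symm
  refine sum_subset (fun n hn => ?_) fun n hn hn' => hf n ?_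
  · simp only [mem_image, mem_Icc, Nat.le_div_iff_mul_le hd] at hn ⊢
    obtain ⟨q, ⟨h1, h2⟩, rfl⟩ := hn
    exact ⟨Nat.mul_pos hd h1, by linarith⟩
  · rintro ⟨q, rfl⟩
    refine hn' (mem_image_of_mem _ ?_)
    rw [mem_Icc] at hn ⊢
    rw [Nat.le_div_iff_mul_le hd]
    exact ⟨Nat.pos_of_ne_zero (by rintro rfl; simp at hn), by linarith⟩

/-- If all the quotients of `n` by the members of a family are squarefree, then so is the quotient
by their greatest common divisor. -/
theorem Nat.squarefree_div_gcd {ι : Type*} {S : Finset ι} (hS : S.Nonempty) {k : ι → ℕ}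
    (hk : ∀ j ∈ S, 0 < k j) {n : ℕ} (hkn : ∀ j ∈ S, k j ∣ n)
    (h : ∀ j ∈ S, Squarefree (n / k j)) : Squarefree (n / S.gcd k) := by
  obtain ⟨g, hg, hg1⟩ := extract_gcd k hS
  rw [Nat.squarefree_iff_prime_squarefree]
  intro p hp hpn
  obtain ⟨j, hj, hpj⟩ : ∃ j ∈ S, ¬ p ∣ g j := by
    by_contra! hcon
    have := Finset.dvd_gcd hcon
    rw [hg1] at this
    exact hp.one_lt.ne' (Nat.dvd_one.1 this)
  obtain ⟨r, rfl⟩ := hkn j hj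
  have hj0 := hk j hj
  have hsq := h j hj
  rw [Nat.mul_div_cancel_left _ hj0] at hsq
  have hG : 0 < S.gcd k := Nat.pos_of_ne_zero fun h0 => by
    rw [hg j hj, h0, zero_mul] at hj0
    exact hj0.false
  have e : k j * r / S.gcd k = g j * r := by
    conv_lhs => rw [hg j hj]
    rw [mul_assoc, Nat.mul_div_cancel_left _ hG]
  rw [e] at hpn
  have hcop : (p * p).Coprime (g j) := by
    have := (Nat.Prime.coprime_iff_not_dvd hp).2 hpj
    exact this.mul_left this
  exact (Nat.squarefree_iff_prime_squarefree.1 hsq) p hp (hcop.dvd_of_dvd_mul_left hpn)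

theorem card_filter_le_val (s t : ℕ) : #{j : Fin s | t ≤ (j : ℕ)} = s - t := by
  rw [← card_map Fin.valEmbedding, ← Nat.card_Ico t s]
  congr 1
  ext x
  simp only [Finset.mem_map, mem_filter, mem_univ, true_and, Fin.valEmbedding_apply, mem_Ico]
  exact ⟨fun ⟨j, h, e⟩ => e ▸ ⟨h, j.2⟩, fun h => ⟨⟨x, h.2⟩, h.1, rfl⟩⟩

/-- The even part of the product of the factors attached to a family of signs. -/
theorem prod_add_prod_neg {s t : ℕ} (hs : 1 ≤ s) {c : Fin s → ℤ}
    (hc : ∀ j, c j = 1 ∨ c j = -1) :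
    (∏ j : Fin s, if (j : ℕ) < t then ((c j : ℝ) ^ 2 - c j) / 2 else -(c j : ℝ)) +
      (∏ j : Fin s, if (j : ℕ) < t then ((-(c j) : ℝ) ^ 2 - -(c j)) / 2 else -(-(c j : ℝ))) =
    2 * ((if t = 0 ∧ Even s then 1
      else if 1 ≤ t ∧ (∀ i j : Fin s, (i : ℕ) < t → (j : ℕ) < t → c i = c j) then
        (c ⟨0, hs⟩ : ℝ) ^ (s - t) / 2
      else 0) * ∏ j ∈ univ.filter (fun j : Fin s => t ≤ (j : ℕ)), (c j : ℝ)) := by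
  rw [prod_ite, prod_ite]
  simp only [not_lt, neg_neg]
  rw [prod_neg, card_filter_le_val]
  set P := ∏ j ∈ univ.filter (fun j : Fin s => t ≤ (j : ℕ)), (c j : ℝ)
  rcases Nat.eq_zero_or_pos t with rfl | ht
  · rcases Nat.even_or_odd s with h | h
    · simp [h, h.neg_one_pow]
      ring
    · simp [h.neg_one_pow, Nat.not_even_iff_odd.2 h]
  by_cases hall : ∀ i j : Fin s, (i : ℕ) < t → (j : ℕ) < t → c i = c j
  · rw [if_neg (by omega), if_pos ⟨ht, hall⟩]
    have hz : (⟨0, hs⟩ : Fin s) ∈ ({j : Fin s | (j : ℕ) < t} : Finset (Fin s)) := by simpa using ht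
    have hce : ∀ j ∈ ({j : Fin s | (j : ℕ) < t} : Finset (Fin s)), c j = c ⟨0, hs⟩ :=
      fun j hj => hall _ _ (by simpa using hj) ht
    rcases hc ⟨0, hs⟩ with h0 | h0
    · have e1 : ∏ j ∈ univ.filter (fun j : Fin s => (j : ℕ) < t),
          ((-(c j) : ℝ) ^ 2 - -(c j)) / 2 = 1 :=
        prod_eq_one fun j hj => by rw [hce j hj, h0]; norm_num
      rw [prod_eq_zero hz (by simp [h0]), e1, h0]
      simp
    · have e1 : ∏ j ∈ univ.filter (fun j : Fin s => (j : ℕ) < t),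
          ((c j : ℝ) ^ 2 - c j) / 2 = 1 :=
        prod_eq_one fun j hj => by rw [hce j hj, h0]; norm_num
      rw [e1, h0, prod_eq_zero (f := fun j => ((-(c j) : ℝ) ^ 2 - -(c j)) / 2) hz (by simp [h0])]
      push_cast
      ring
  · rw [if_neg (by omega), if_neg fun h => hall h.2]
    push Not at hall
    obtain ⟨i, j, hi, hj, hij⟩ := hall
    have hi' : i ∈ ({j : Fin s | (j : ℕ) < t} : Finset (Fin s)) := by simpa using hi
    have hj' : j ∈ ({j : Fin s | (j : ℕ) < t} : Finset (Fin s)) := by simpa using hj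
    rcases hc i with h1 | h1 <;> rcases hc j with h2 | h2
    · exact absurd (h1.trans h2.symm) hij
    · rw [prod_eq_zero hi' (by simp [h1]), prod_eq_zero hj' (by simp [h2])]
      simp
    · rw [prod_eq_zero hj' (by simp [h2]), prod_eq_zero hi' (by simp [h1])]
      simp
    · exact absurd (h1.trans h2.symm) hij

open ArithmeticFunction in
theorem moebius_eq_zero_or_one_or_neg_one (n : ℕ) :
    moebius n = 0 ∨ moebius n = 1 ∨ moebius n = -1 := by
  have := moebius_eq_or n
  tauto

open ArithmeticFunction in
theorem muIf_eq_zero_or_one_or_neg_one (n d : ℕ) :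
    muIf n d = 0 ∨ muIf n d = 1 ∨ muIf n d = -1 := by
  rw [muIf]
  split_ifs
  · exact moebius_eq_zero_or_one_or_neg_one _
  · exact Or.inl rfl

open ArithmeticFunction in
theorem moebius_eq_one_or_neg_one {n : ℕ} (h : Squarefree n) :
    moebius n = 1 ∨ moebius n = -1 :=
  (moebius_eq_zero_or_one_or_neg_one n).resolve_left (moebius_ne_zero_iff_squarefree.2 h)

/-- An even function plus an odd function: every function on `{0, 1, -1}` vanishing at `0` is a
combination of `x ^ 2` and `x`. -/
theorem eq_sq_add_of_sign {F : ℤ → ℝ} (h0 : F 0 = 0) {x : ℤ} (hx : x = 0 ∨ x = 1 ∨ x = -1) :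
    F x = (F 1 + F (-1)) / 2 * (x : ℝ) ^ 2 + (F 1 - F (-1)) / 2 * x := by
  rcases hx with rfl | rfl | rfl
  · simp [h0]
  · push_cast
    ring
  · push_cast
    ring

open ArithmeticFunction in
/-- The product attached to a partition, as a function of `n`. -/
theorem exists_prod_muIf_eq {s : ℕ} (hs : 1 ≤ s) {k : Fin s → ℕ} (hk : ∀ j, 0 < k j) (t : ℕ)
    {L G : ℕ} (hL : L = univ.lcm k) (hG : G = univ.gcd k) {ε : ℤ} (hε : ε = 1 ∨ ε = -1)
    {f : ℤ → Fin s → ℝ}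
    (hf : f = fun (a : ℤ) (j : Fin s) => if (j : ℕ) < t then ((a : ℝ) ^ 2 - a) / 2 else -(a : ℝ)) :
    ∃ β : ℝ, ∀ q : ℕ, 0 < q → ∏ j, f (ε * muIf (L * q) (k j)) j =
      if (L / G).Coprime q then
        ((if t = 0 ∧ Even s ∧ moebius (L / G) ≠ 0 then 1
          else if 1 ≤ t ∧ (∀ i j : Fin s, (i : ℕ) < t → (j : ℕ) < t →
              moebius (L / k i) = moebius (L / k j)) ∧ moebius (L / G) ≠ 0 then
            (moebius (L / k ⟨0, hs⟩) : ℝ) ^ (s - t) / 2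
          else 0) * ∏ j ∈ univ.filter (fun j : Fin s => t ≤ (j : ℕ)),
            (moebius (L / k j) : ℝ)) * (moebius q : ℝ) ^ 2 + β * moebius q
      else 0 := by
  have hf0 : ∀ j, f 0 j = 0 := fun j => by rw [hf]; simp
  have hkL : ∀ j, k j ∣ L := fun j => hL ▸ dvd_lcm (mem_univ j)
  have hGk : ∀ j, G ∣ k j := fun j => hG ▸ gcd_dvd (mem_univ j)
  let j₀ : Fin s := ⟨0, hs⟩
  have hG0 : 0 < G := Nat.pos_of_dvd_of_pos (hGk j₀) (hk j₀)
  have hGL : G ∣ L := (hGk j₀).trans (hkL j₀)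
  -- the quotient by the greatest common divisor has to be squarefree
  have hzero : ∀ q, 0 < q → ¬ Squarefree (L / G * q) →
      ∏ j, f (ε * muIf (L * q) (k j)) j = 0 := by
    intro q hq hsq
    by_contra hne
    refine hsq ?_
    rw [Nat.div_mul_right_comm hGL, hG]
    refine Nat.squarefree_div_gcd ⟨j₀, mem_univ _⟩ (fun j _ => hk j)
      (fun j _ => (hkL j).mul_right q) fun j _ => ?_
    by_contra hj
    refine hne (prod_eq_zero (mem_univ j) ?_)
    rw [muIf, moebius_eq_zero_of_not_squarefree hj, ite_self, mul_zero, hf0]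
  by_cases hD : Squarefree (L / G)
  swap
  · refine ⟨0, fun q hq => ?_⟩
    rw [hzero q hq fun h => hD (h.squarefree_of_dvd (dvd_mul_right _ _)),
      moebius_eq_zero_of_not_squarefree hD]
    simp
  have hcD : ∀ j, L / k j ∣ L / G := fun j => Nat.div_dvd_div_left (hkL j) (hGk j)
  have hc : ∀ j, moebius (L / k j) = 1 ∨ moebius (L / k j) = -1 := fun j =>
    moebius_eq_one_or_neg_one (hD.squarefree_of_dvd (hcD j))
  have key := prod_add_prod_neg (t := t) hs hc
  have hmu := moebius_ne_zero_iff_squarefree.2 hD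
  set F : ℤ → ℝ := fun x => ∏ j, f (ε * (moebius (L / k j) * x)) j with hF
  have hF0 : F 0 = 0 := prod_eq_zero (mem_univ j₀) (by simp [hf0])
  have hFF := Eq.trans (a := F 1 + F (-1)) (by
    rcases hε with rfl | rfl
    · simp [hF, hf]
    · rw [add_comm]
      simp [hF, hf, sub_eq_add_neg]) key
  simp only [ne_eq, hmu, not_false_eq_true, and_true]
  refine ⟨(F 1 - F (-1)) / 2, fun q hq => ?_⟩
  by_cases hq' : (L / G).Coprime q
  · have e1 : ∏ j, f (ε * muIf (L * q) (k j)) j = F (moebius q) := by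
      refine prod_congr rfl fun j _ => ?_
      rw [muIf, if_pos ((hkL j).mul_right q), ← Nat.div_mul_right_comm (hkL j),
        isMultiplicative_moebius.map_mul_of_coprime (hq'.coprime_dvd_left (hcD j))]
    rw [if_pos hq', e1, eq_sq_add_of_sign hF0 (moebius_eq_zero_or_one_or_neg_one q), hFF,
      mul_div_cancel_left₀ _ two_ne_zero]
  · rw [if_neg hq']
    exact hzero q hq fun h => hq' (Nat.squarefree_mul_iff.1 h).1

theorem stmt15 (s : ℕ) (hs : 1 ≤ s)
    -- the distinct parts `k₁, …, k_s`, indexed so that the multiplicities are decreasing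
    (k : Fin s → ℕ) (hkpos : ∀ j, 0 < k j) (hkinj : Function.Injective k)
    -- the multiplicities `n_{k₁} ≥ n_{k₂} ≥ ⋯ ≥ n_{k_s} ≥ 1`
    (m : Fin s → ℕ) (hm1 : ∀ j, 1 ≤ m j)
    (hmono : ∀ i j : Fin s, i ≤ j → m j ≤ m i)
    -- `t` is the largest index with `m t ≥ 2` (here: the number of indices with `m ≥ 2`)
    (t : ℕ) (ht : t ≤ s) (htdef : ∀ j : Fin s, 2 ≤ m j ↔ (j : ℕ) < t)
    (L G : ℕ) (hL : L = Finset.univ.lcm k) (hG : G = Finset.univ.gcd k)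
    (ε : ℤ) (hε : ε = 1 ∨ ε = -1)
    (e₁ e₂ : ℝ)
    (he₁ : e₁ =
      if t = 0 ∧ Even s ∧ ArithmeticFunction.moebius (L / G) ≠ 0 then 1
      else if 1 ≤ t ∧
          (∀ i j : Fin s, (i : ℕ) < t → (j : ℕ) < t →
            ArithmeticFunction.moebius (L / k i) = ArithmeticFunction.moebius (L / k j)) ∧
          ArithmeticFunction.moebius (L / G) ≠ 0 then
        ((ArithmeticFunction.moebius (L / k ⟨0, hs⟩) : ℝ)) ^ (s - t) / 2
      else 0)
    (he₂ : e₂ = e₁ * ∏ j ∈ Finset.univ.filter (fun j : Fin s => t ≤ (j : ℕ)),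
        (ArithmeticFunction.moebius (L / k j) : ℝ)) :
    Tendsto (fun N : ℕ =>
        (∑ n ∈ Finset.Icc 1 N, ∏ j : Fin s,
          (-1 : ℝ) ^ (m j) * genBinom ((ε * muIf n (k j) : ℤ) : ℝ) (m j)) / N)
      atTop
      (nhds ((6 / Real.pi ^ 2) * e₂ /
        (G * ∏ p ∈ (L / G).primeFactors, ((p : ℝ) + 1)))) := by
  set f : ℤ → Fin s → ℝ :=
    fun a j => if (j : ℕ) < t then ((a : ℝ) ^ 2 - a) / 2 else -(a : ℝ) with hf
  obtain ⟨β, hβ⟩ := exists_prod_muIf_eq hs hkpos t hL hG hε hf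
  rw [← he₁, ← he₂] at hβ
  have hkL : ∀ j, k j ∣ L := fun j => hL ▸ dvd_lcm (mem_univ j)
  have hL0 : 0 < L := Nat.pos_of_ne_zero fun h => by
    rw [hL, Finset.lcm_eq_zero_iff] at h
    obtain ⟨j, -, hj⟩ := h
    exact (hkpos j).ne' hj
  have hGL : G ∣ L := (hG ▸ gcd_dvd (mem_univ (⟨0, hs⟩ : Fin s)) : G ∣ k ⟨0, hs⟩).trans (hkL _)
  have hG0 : 0 < G := Nat.pos_of_dvd_of_pos hGL hL0
  have hLG : L = G * (L / G) := (Nat.mul_div_cancel' hGL).symm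
  set D := L / G with hDdef
  have hD0 : D ≠ 0 := fun h => by rw [h, mul_zero] at hLG; exact hL0.ne' hLG
  have hterm : ∀ n, ∏ j : Fin s,
      (-1 : ℝ) ^ (m j) * genBinom ((ε * muIf n (k j) : ℤ) : ℝ) (m j) =
        ∏ j, f (ε * muIf n (k j)) j := by
    refine fun n => prod_congr rfl fun j _ => ?_
    rw [neg_one_pow_mul_genBinom _ (hm1 j)]
    · exact if_congr (htdef j) rfl rfl
    · rcases hε with rfl | rfl <;> rcases muIf_eq_zero_or_one_or_neg_one n (k j) with h | h | h <;>
        simp [h]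
  have hsum : ∀ N : ℕ, ∑ n ∈ Icc 1 N, ∏ j : Fin s,
      (-1 : ℝ) ^ (m j) * genBinom ((ε * muIf n (k j) : ℤ) : ℝ) (m j) =
        e₂ * (∑ q ∈ Icc 1 (N / L),
          if D.Coprime q then (ArithmeticFunction.moebius q : ℝ) ^ 2 else 0) +
        β * ∑ q ∈ Icc 1 (N / L),
          if D.Coprime q then (ArithmeticFunction.moebius q : ℝ) else 0 := by
    intro N
    rw [sum_congr rfl fun n _ => hterm n, sum_Icc_eq_sum_Icc_div hL0, mul_sum, mul_sum,
      ← sum_add_distrib]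
    · refine sum_congr rfl fun q hq => ?_
      rw [hβ q (by rw [mem_Icc] at hq; omega)]
      split_ifs <;> simp
    · intro n hn
      obtain ⟨j, hj⟩ : ∃ j, ¬ k j ∣ n := by
        by_contra! hcon
        exact hn (hL ▸ Finset.lcm_dvd fun j _ => hcon j)
      exact prod_eq_zero (mem_univ j) (by simp [hf, muIf, hj])
  have hdiv : Tendsto (fun N : ℕ => N / L) atTop atTop := Nat.tendsto_div_const_atTop hL0.ne'
  have hlim := ((((tendsto_sum_coprime_moebius_sq_div hD0).const_mul e₂).add
    ((tendsto_sum_coprime_moebius_div hD0).const_mul β)).comp hdiv).mul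
      (tendsto_natCast_div_div (d := L))
  refine (hlim.congr' ?_).trans (le_of_eq (congrArg nhds ?_))
  · filter_upwards [eventually_ge_atTop L] with N hN
    have : ((N / L : ℕ) : ℝ) ≠ 0 := by
      exact_mod_cast (Nat.div_pos hN hL0).ne'
    rw [hsum]
    simp only [Function.comp_apply]
    field_simp
  · by_cases hD : Squarefree D
    · have hGr : (G : ℝ) ≠ 0 := by exact_mod_cast hG0.ne'
      have hDp : (∏ p ∈ D.primeFactors, (p : ℝ)) = D := by
        rw [← Nat.cast_prod, Nat.prod_primeFactors_of_squarefree hD]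
      have hDr : (D : ℝ) ≠ 0 := by exact_mod_cast hD0
      have hP : ∏ p ∈ D.primeFactors, ((p : ℝ) + 1) ≠ 0 :=
        prod_ne_zero_iff.2 fun p _ => by positivity
      rw [prod_div_distrib, hDp, hLG]
      push_cast
      field_simp
      ring
    · have : e₂ = 0 := by
        rw [he₂, he₁, ArithmeticFunction.moebius_eq_zero_of_not_squarefree hD]
        simp
      simp [this]
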